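/- arXiv:2409.11312 — 4 statements merged into one kernel-verified Lean document; each statement's English description precedes it below -/
import Mathlib

section
/- Let β and γ be integers with β > γ and β − γ < k_d − k_c. Then there exists j ∈ {1,…,n−k_c} such that p̃_j · O(q₁, β) ≠ p̃_j · O(q₁, γ) in F₂; equivalently, O(q₁, β) + O(q₁, γ) ∉ C. -/
open Polynomial

abbrev F2 := ZMod 2

abbrev Vec (n : ℕ) := ZMod n → F2

/-- Standard dot product on `F₂`-vectors indexed by a finite type. -/
def dot {ι : Type} [Fintype ι] (u v : ι → F2) : F2 := ∑ i, u i * v i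

/-- Right cyclic shift by `α` positions (indices mod `n`). -/
def shiftR {n : ℕ} (c : Vec n) (α : ℤ) : Vec n := fun i => c (i - (α : ZMod n))

/-- Vectorization of a polynomial: `c₀+c₁x+⋯ ↦ (c₀,c₁,…,c_{n-1})`. -/
def polyVec {n : ℕ} (f : Polynomial F2) : Vec n := fun i => f.coeff i.val

/-- A binary cyclic code: a subspace of `F₂ⁿ` closed under cyclic shift. -/
def IsCyclicCode {n : ℕ} (C : Submodule F2 (Vec n)) : Prop :=
  ∀ c ∈ C, shiftR c 1 ∈ C

/-- Dual code with respect to the standard dot product. -/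
def dualCode {ι : Type} [Fintype ι] (C : Submodule F2 (ι → F2)) :
    Submodule F2 (ι → F2) where
  carrier := {w | ∀ c ∈ C, dot c w = 0}
  add_mem' := by
    intro a b ha hb c hc
    have h1 := ha c hc
    have h2 := hb c hc
    simp only [dot, Set.mem_setOf_eq, Pi.add_apply, mul_add, Finset.sum_add_distrib] at *
    rw [h1, h2, add_zero]
  zero_mem' := by
    intro c hc
    simp [dot]
  smul_mem' := by
    intro r a ha c hc
    have h := ha c hc
    simp only [dot, Set.mem_setOf_eq, Pi.smul_apply, smul_eq_mul] at *
    calc (∑ i, c i * (r * a i)) = r * ∑ i, c i * a i := by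
          rw [Finset.mul_sum]
          exact Finset.sum_congr rfl fun i _ => by ring
      _ = 0 := by rw [h, mul_zero]

/-- `g` is the generator polynomial of the cyclic code `C`: monic, divides `xⁿ−1`,
and `C` consists exactly of the vectorizations of the multiples `f·g` with
`deg f < n − deg g`. -/
structure IsGenPoly {n : ℕ} [NeZero n] (C : Submodule F2 (Vec n)) (g : Polynomial F2) :
    Prop where
  monic : g.Monic
  dvd : g ∣ (X ^ n - 1)
  mem_iff : ∀ v : Vec n, v ∈ C ↔
    ∃ f : Polynomial F2, f.degree < ((n - g.natDegree : ℕ) : WithBot ℕ) ∧ v = polyVec (f * g)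

theorem shiftR_shiftR {n : ℕ} (c : Vec n) (a b : ℤ) :
    shiftR (shiftR c a) b = shiftR c (a + b) := by
  funext i
  simp only [shiftR]
  congr 1
  push_cast
  ring

theorem shiftR_zero {n : ℕ} (c : Vec n) : shiftR c 0 = c := by
  funext i
  simp [shiftR]

theorem shiftR_add {n : ℕ} (c d : Vec n) (a : ℤ) :
    shiftR (c + d) a = shiftR c a + shiftR d a := rfl

theorem IsCyclicCode.shiftR_natCast_mem {n : ℕ} {C : Submodule F2 (Vec n)} (hC : IsCyclicCode C)
    {c : Vec n} (hc : c ∈ C) (m : ℕ) : shiftR c m ∈ C := by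
  induction m with
  | zero => simpa [shiftR_zero] using hc
  | succ m ih =>
    have h := hC _ ih
    rw [shiftR_shiftR] at h
    exact_mod_cast h

theorem IsCyclicCode.shiftR_mem {n : ℕ} [NeZero n] {C : Submodule F2 (Vec n)}
    (hC : IsCyclicCode C) {c : Vec n} (hc : c ∈ C) (a : ℤ) : shiftR c a ∈ C := by
  have h := hC.shiftR_natCast_mem hc (a : ZMod n).val
  have heq : shiftR c ((a : ZMod n).val : ℤ) = shiftR c a := by
    funext i
    simp only [shiftR, Int.cast_natCast, ZMod.natCast_zmod_val]
  rwa [heq] at h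

theorem polyVec_add {n : ℕ} (f g : F2[X]) :
    (polyVec (f + g) : Vec n) = polyVec f + polyVec g := by
  funext i
  simp [polyVec]

theorem polyVec_injOn {n : ℕ} [NeZero n] {f g : F2[X]} (hf : f.natDegree < n)
    (hg : g.natDegree < n) (h : (polyVec f : Vec n) = polyVec g) : f = g := by
  ext k
  rcases lt_or_ge k n with hk | hk
  · simpa [polyVec, ZMod.val_natCast_of_lt hk] using congrFun h (k : ZMod n)
  · rw [coeff_eq_zero_of_natDegree_lt (hf.trans_le hk),
      coeff_eq_zero_of_natDegree_lt (hg.trans_le hk)]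

theorem shiftR_polyVec {n : ℕ} [NeZero n] {g : F2[X]} {m : ℕ} (h : m + g.natDegree < n) :
    shiftR (polyVec g : Vec n) m = polyVec (X ^ m * g) := by
  funext i
  have hm : ((m : ZMod n)).val = m := ZMod.val_natCast_of_lt (by omega)
  simp only [shiftR, polyVec, Int.cast_natCast, coeff_X_pow_mul']
  split_ifs with hi
  · rw [ZMod.val_sub (by omega), hm]
  · apply coeff_eq_zero_of_natDegree_lt
    have hv : (i - (m : ZMod n)).val = i.val + (n - m) := by
      have : i - (m : ZMod n) = ((i.val + (n - m) : ℕ) : ZMod n) := by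
        rw [Nat.cast_add, Nat.cast_sub (by omega)]
        simp [sub_eq_add_neg]
      rw [this, ZMod.val_natCast_of_lt (by omega)]
    omega

theorem dot_add_right {ι : Type} [Fintype ι] (u v w : ι → F2) :
    dot u (v + w) = dot u v + dot u w := by
  simp [dot, mul_add, Finset.sum_add_distrib]

/-- A vector outside a code is detected by a parity check of that code. -/
theorem exists_mem_dualCode_dot_ne_zero {ι : Type} [Fintype ι] {C : Submodule F2 (ι → F2)}
    {v : ι → F2} (hv : v ∉ C) : ∃ w ∈ dualCode C, dot w v ≠ 0 := by
  classical
  obtain ⟨φ, hφv, hφC⟩ := Submodule.exists_le_ker_of_notMem hv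
  have hφ : ∀ u, dot u (fun i => φ (Pi.single i 1)) = φ u := fun u => by
    conv_rhs => rw [pi_eq_sum_univ' u, map_sum]
    simp [dot]
  refine ⟨fun i => φ (Pi.single i 1), fun c hc => (hφ c).trans (hφC hc), ?_⟩
  have hcomm : dot (fun i => φ (Pi.single i 1)) v = dot v (fun i => φ (Pi.single i 1)) := by
    simp [dot, mul_comm]
  rwa [hcomm, hφ]

theorem dot_polyVec_mul {n : ℕ} [NeZero n] {f g : F2[X]} {N : ℕ} (hf : f.natDegree < N)
    (hN : N + g.natDegree ≤ n) (v : Vec n) :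
    dot (polyVec (f * g)) v =
      ∑ m ∈ Finset.range N, f.coeff m * dot (shiftR (polyVec g : Vec n) m) v := by
  have hvec : ∀ i : ZMod n, (polyVec (f * g) : Vec n) i =
      ∑ m ∈ Finset.range N, f.coeff m * shiftR (polyVec g : Vec n) m i := fun i => by
    conv_lhs => rw [polyVec, f.as_sum_range' N hf, Finset.sum_mul, finsetSum_coeff]
    refine Finset.sum_congr rfl fun m hm => ?_
    rw [shiftR_polyVec (by have := Finset.mem_range.mp hm; omega), polyVec,
      ← C_mul_X_pow_eq_monomial, mul_assoc, coeff_C_mul]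
  simp only [dot, hvec, Finset.sum_mul, Finset.mul_sum]
  rw [Finset.sum_comm]
  simp only [mul_assoc]

/-- Two distinct shifts of a low-degree word differ by a polynomial of degree too small to lie
in the code. -/
theorem shiftR_add_shiftR_notMem {n : ℕ} [NeZero n] {C : Submodule F2 (Vec n)}
    (hC : IsCyclicCode C) {p q : F2[X]} (hp : IsGenPoly C p) (hq : q ≠ 0) {β γ : ℤ}
    (hβγ : γ < β) (hdeg : β - γ + q.natDegree < p.natDegree) (hpn : p.natDegree ≤ n) :
    shiftR (polyVec q : Vec n) β + shiftR (polyVec q : Vec n) γ ∉ C := by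
  intro hmem
  obtain ⟨d, hd⟩ := Int.eq_ofNat_of_zero_le (sub_nonneg.mpr hβγ.le)
  have hd0 : d ≠ 0 := by omega
  have hlt : d + q.natDegree < p.natDegree := by omega
  have hmem' := hC.shiftR_mem hmem (-γ)
  have hvec : shiftR (shiftR (polyVec q : Vec n) β + shiftR (polyVec q : Vec n) γ) (-γ) =
      polyVec ((X ^ d + 1) * q) := by
    rw [shiftR_add, shiftR_shiftR, shiftR_shiftR, ← sub_eq_add_neg, hd, add_neg_cancel,
      shiftR_polyVec (by omega), add_mul, one_mul, polyVec_add, shiftR_zero]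
  rw [hvec, hp.mem_iff] at hmem'
  obtain ⟨f, hf, hfeq⟩ := hmem'
  have hmonic : (X ^ d + 1 : F2[X]).Monic := by
    simpa using monic_X_pow_add_C (1 : F2) hd0
  have hdegL : ((X ^ d + 1) * q).natDegree = d + q.natDegree := by
    rw [hmonic.natDegree_mul' hq]
    congr 1
    simpa using natDegree_X_pow_add_C (n := d) (r := (1 : F2))
  have hne : (X ^ d + 1) * q ≠ 0 := mul_ne_zero hmonic.ne_zero hq
  have hdegR : (f * p).natDegree < n := by
    rcases eq_or_ne f 0 with rfl | hf0
    · simpa using NeZero.pos n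
    · have := (natDegree_lt_iff_degree_lt hf0).mpr hf
      rw [natDegree_mul hf0 hp.monic.ne_zero]
      omega
  have heq := polyVec_injOn (by omega) hdegR hfeq
  exact hne (eq_zero_of_dvd_of_natDegree_lt ⟨f, heq.trans (mul_comm f p)⟩ (by omega))

/-- If `γ < β` and `β − γ < k_d − k_c`, then some check row `p̃_j`
(`1 ≤ j ≤ n−k_c`) distinguishes the shifts `O(q₁,β)` and `O(q₁,γ)`; equivalently
`O(q₁,β) + O(q₁,γ) ∉ C`. -/
theorem stmt0 (n kc kd : ℕ) [NeZero n] (C D : Submodule F2 (Vec n))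
    (hCcyc : IsCyclicCode C) (hDcyc : IsCyclicCode D)
    (hdimC : Module.finrank F2 C = kc) (hdimD : Module.finrank F2 D = kd)
    (hCperp : dualCode C < C) (hCD : C < D) (hkckd : kc < kd)
    (p q pR qR : Polynomial F2)
    (hp : IsGenPoly C p) (hq : IsGenPoly D q)
    (hpR : IsGenPoly (dualCode C) pR) (hqR : IsGenPoly (dualCode D) qR)
    (hdegp : p.natDegree = n - kc) (hdegq : q.natDegree = n - kd)
    (hdegpR : pR.natDegree = kc) (hdegqR : qR.natDegree = kd)
    (β γ : ℤ) (hβγ : γ < β) (hlt : β - γ < (kd : ℤ) - (kc : ℤ)) :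
    (∃ j : ℕ, 1 ≤ j ∧ j ≤ n - kc ∧
        dot (shiftR (polyVec pR : Vec n) ((j : ℤ) - 1)) (shiftR (polyVec q : Vec n) β) ≠
        dot (shiftR (polyVec pR : Vec n) ((j : ℤ) - 1)) (shiftR (polyVec q : Vec n) γ)) ∧
    shiftR (polyVec q : Vec n) β + shiftR (polyVec q : Vec n) γ ∉ C := by
  have hkd : kd ≤ n := by
    have h := Submodule.finrank_le D
    rwa [hdimD, Module.finrank_pi, ZMod.card] at h
  have hnotMem : shiftR (polyVec q : Vec n) β + shiftR (polyVec q : Vec n) γ ∉ C :=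
    shiftR_add_shiftR_notMem hCcyc hp hq.monic.ne_zero hβγ (by omega) (by omega)
  refine ⟨?_, hnotMem⟩
  obtain ⟨w, hw, hwv⟩ := exists_mem_dualCode_dot_ne_zero hnotMem
  obtain ⟨f, hf, rfl⟩ := (hpR.mem_iff w).mp hw
  rw [hdegpR] at hf
  have hf' : f.natDegree < n - kc := by
    rcases eq_or_ne f 0 with rfl | hf0
    · simp only [natDegree_zero]
      omega
    · exact (natDegree_lt_iff_degree_lt hf0).mpr hf
  rw [dot_polyVec_mul hf' (by omega)] at hwv
  obtain ⟨m, hm, hne⟩ := Finset.exists_ne_zero_of_sum_ne_zero hwv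
  have hmlt := Finset.mem_range.mp hm
  refine ⟨m + 1, by omega, by omega, fun heq => hne ?_⟩
  rw [Nat.cast_add, Nat.cast_one, add_sub_cancel_right] at heq
  rw [dot_add_right, heq, CharTwo.add_self_eq_zero, mul_zero]
end

section
/- Let a_l and a_r be nonnegative integers with a_l + a_r < k_d − k_c. Then the map sending each integer α with −a_l ≤ α ≤ a_r to the tuple (p̃_j · O(q₁, −α))_{j=1,…,n−k_c} ∈ F₂^{n−k_c} is injective; i.e., distinct α in this range give distinct syndrome tuples H_C·O(q₁,−α)ᵀ, where the rows of H_C are p̃_1,…,p̃_{n−k_c}. -/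
open Polynomial

theorem polyVec_sub {n : ℕ} (f g : F2[X]) :
    (polyVec (f - g) : Vec n) = polyVec f - polyVec g := by
  ext i; simp [polyVec]

theorem polyVec_smul {n : ℕ} (a : F2) (f : F2[X]) :
    (polyVec (a • f) : Vec n) = a • polyVec f := by
  ext i; simp [polyVec]

/-- Vectorization is injective on polynomials of degree less than `n`. -/
theorem polyVec_injective_of_degree_lt {n : ℕ} [NeZero n] {f g : F2[X]}
    (hf : f.degree < n) (hg : g.degree < n) (h : (polyVec f : Vec n) = polyVec g) : f = g := by
  ext i
  rcases lt_or_ge i n with hi | hi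
  · simpa [polyVec, ZMod.val_natCast_of_lt hi] using congrFun h (i : ZMod n)
  · have hi' : (n : WithBot ℕ) ≤ i := by exact_mod_cast hi
    rw [coeff_eq_zero_of_degree_lt (hf.trans_le hi'), coeff_eq_zero_of_degree_lt (hg.trans_le hi')]

/-- As long as no wrap-around occurs, multiplying by `x ^ k` is the right shift by `k`. -/
theorem polyVec_X_pow_mul {n : ℕ} [NeZero n] (g : F2[X]) (k : ℕ) (h : k + g.natDegree < n) :
    (polyVec (X ^ k * g) : Vec n) = shiftR (polyVec g) k := by
  ext i
  have hi : i.val < n := ZMod.val_lt i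
  have hcast : ((i.val : ℕ) : ZMod n) = i := ZMod.natCast_zmod_val i
  simp only [polyVec, shiftR, coeff_X_pow_mul', Int.cast_natCast]
  split_ifs with hk
  · have : i - (k : ZMod n) = ((i.val - k : ℕ) : ZMod n) := by
      rw [Nat.cast_sub hk, hcast]
    rw [this, ZMod.val_natCast_of_lt (by omega)]
  · have : i - (k : ZMod n) = ((i.val + n - k : ℕ) : ZMod n) := by
      rw [Nat.cast_sub (by omega), Nat.cast_add, hcast, ZMod.natCast_self, add_zero]
    rw [this, ZMod.val_natCast_of_lt (by omega), coeff_eq_zero_of_natDegree_lt (by omega)]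

theorem shiftR_sub {n : ℕ} (c d : Vec n) (a : ℤ) :
    shiftR (c - d) a = shiftR c a - shiftR d a := rfl

theorem dot_comm {ι : Type} [Fintype ι] (u v : ι → F2) : dot u v = dot v u :=
  dotProduct_comm u v

theorem dot_sub {ι : Type} [Fintype ι] (u v w : ι → F2) :
    dot u (v - w) = dot u v - dot u w :=
  dotProduct_sub u v w

theorem dualCode_dualCode {ι : Type} [Fintype ι] (C : Submodule F2 (ι → F2)) :
    dualCode (dualCode C) = C := by
  classical
  let B : LinearMap.BilinForm F2 (ι → F2) := dotProductBilin F2 F2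
  have hB : ∀ u v, B u v = dot u v := fun _ _ => rfl
  have hrefl : B.IsRefl := fun u v h => by rwa [hB, dot_comm, ← hB]
  have hnd : B.Nondegenerate := by
    refine hrefl.nondegenerate_iff_separatingLeft.2 fun u hu => ?_
    exact dotProduct_eq_zero u hu
  have hdual : ∀ W : Submodule F2 (ι → F2), dualCode W = B.orthogonal W := fun W => rfl
  rw [hdual, hdual, LinearMap.BilinForm.orthogonal_orthogonal hnd hrefl]

theorem IsGenPoly.natDegree_le {n : ℕ} [NeZero n] {C : Submodule F2 (Vec n)} {g : F2[X]}
    (hg : IsGenPoly C g) : g.natDegree ≤ n := by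
  have hdvd : g ∣ X ^ n - Polynomial.C 1 := hg.dvd
  exact (natDegree_le_of_dvd hdvd (X_pow_sub_C_ne_zero (NeZero.pos n) 1)).trans_eq
    natDegree_X_pow_sub_C

/-- The shifts of the generator polynomial without wrap-around span the code. -/
theorem IsGenPoly.le_of_shiftR_mem {n : ℕ} [NeZero n] {C W : Submodule F2 (Vec n)} {g : F2[X]}
    (hg : IsGenPoly C g)
    (h : ∀ k : ℕ, k < n - g.natDegree → shiftR (polyVec g : Vec n) k ∈ W) : C ≤ W := by
  intro v hv
  obtain ⟨f, hf, rfl⟩ := (hg.mem_iff v).1 hv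
  let L : F2[X] →ₗ[F2] Vec n :=
    { toFun := fun f => polyVec (f * g)
      map_add' := fun a b => by rw [add_mul, polyVec_add]
      map_smul' := fun a b => by rw [smul_mul_assoc, polyVec_smul, RingHom.id_apply] }
  have hmem : f ∈ W.comap L := by
    rw [← mem_degreeLT, degreeLT_eq_span_X_pow] at hf
    refine Submodule.span_le.2 ?_ hf
    intro x hx
    simp only [Finset.coe_image, Set.mem_image, Finset.coe_range, Set.mem_Iio] at hx
    obtain ⟨k, hk, rfl⟩ := hx
    change polyVec (X ^ k * g) ∈ W
    rw [polyVec_X_pow_mul g k (by omega)]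
    exact h k hk
  exact hmem

/-- A code has no nonzero codeword of degree less than that of its generator polynomial. -/
theorem IsGenPoly.eq_zero_of_natDegree_lt {n : ℕ} [NeZero n] {C : Submodule F2 (Vec n)}
    {g h : F2[X]} (hg : IsGenPoly C g) (hmem : (polyVec h : Vec n) ∈ C)
    (hdeg : h.natDegree < g.natDegree) : h = 0 := by
  obtain ⟨f, hf, hfg⟩ := (hg.mem_iff _).1 hmem
  have hn := hg.natDegree_le
  have hfg_deg : (f * g).degree < n := by
    rcases eq_or_ne f 0 with rfl | hf0
    · simp
    · rw [← natDegree_lt_iff_degree_lt hf0] at hf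
      rw [← natDegree_lt_iff_degree_lt (mul_ne_zero hf0 hg.monic.ne_zero),
        natDegree_mul hf0 hg.monic.ne_zero]
      omega
  have hh : h.degree < n := degree_le_natDegree.trans_lt (by exact_mod_cast hdeg.trans_le hn)
  have heq := polyVec_injective_of_degree_lt hh hfg_deg hfg
  exact eq_zero_of_dvd_of_natDegree_lt ⟨f, by rw [heq, mul_comm]⟩ hdeg

/-- Differences of nearby shifts of a nonzero polynomial lie outside
every cyclic code whose generator polynomial has large enough degree. -/
theorem IsGenPoly.shiftR_sub_shiftR_notMem {n : ℕ} [NeZero n] {C : Submodule F2 (Vec n)}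
    {p q : F2[X]} (hC : IsCyclicCode C) (hp : IsGenPoly C p) (hq : q ≠ 0)
    {a b : ℤ} {d : ℕ} (hd : 0 < d) (hab : a = b + d) (hdeg : d + q.natDegree < p.natDegree) :
    shiftR (polyVec q : Vec n) a - shiftR (polyVec q) b ∉ C := by
  intro hmem
  have hn := hp.natDegree_le
  have hmem' := hC.shiftR_mem hmem (-b)
  rw [shiftR_sub, shiftR_shiftR, shiftR_shiftR, add_neg_cancel, shiftR_zero, hab,
    add_neg_cancel_comm, ← polyVec_X_pow_mul q d (by omega), ← polyVec_sub] at hmem'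
  have hlt : (X ^ d * q - q).natDegree < p.natDegree := by
    refine (natDegree_sub_le _ _).trans_lt (max_lt ?_ (by omega))
    rwa [natDegree_X_pow_mul d hq, add_comm]
  have hzero := hp.eq_zero_of_natDegree_lt hmem' hlt
  have hfac : (X ^ d - Polynomial.C 1) * q = 0 := by rw [sub_mul, C_1, one_mul, hzero]
  exact mul_ne_zero (X_pow_sub_C_ne_zero hd (1 : F2)) hq hfac

/-- For `aₗ + aᵣ < k_d − k_c`, the syndrome tuples
`(p̃_j · O(q₁,−α))_{j=1,…,n−k_c}` are distinct for distinct `α ∈ [−aₗ, aᵣ]`. -/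
theorem stmt1 (n kc kd : ℕ) [NeZero n] (C D : Submodule F2 (Vec n))
    (hCcyc : IsCyclicCode C) (hDcyc : IsCyclicCode D)
    (hdimC : Module.finrank F2 C = kc) (hdimD : Module.finrank F2 D = kd)
    (hCperp : dualCode C < C) (hCD : C < D) (hkckd : kc < kd)
    (p q pR qR : Polynomial F2)
    (hp : IsGenPoly C p) (hq : IsGenPoly D q)
    (hpR : IsGenPoly (dualCode C) pR) (hqR : IsGenPoly (dualCode D) qR)
    (hdegp : p.natDegree = n - kc) (hdegq : q.natDegree = n - kd)
    (hdegpR : pR.natDegree = kc) (hdegqR : qR.natDegree = kd)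
    (al ar : ℕ) (hsum : al + ar < kd - kc) :
    ∀ α α' : ℤ, -(al : ℤ) ≤ α → α ≤ (ar : ℤ) → -(al : ℤ) ≤ α' → α' ≤ (ar : ℤ) →
      (∀ j : ℕ, 1 ≤ j → j ≤ n - kc →
        dot (shiftR (polyVec pR : Vec n) ((j : ℤ) - 1)) (shiftR (polyVec q : Vec n) (-α)) =
        dot (shiftR (polyVec pR : Vec n) ((j : ℤ) - 1)) (shiftR (polyVec q : Vec n) (-α'))) →
      α = α' := by
  have hkd : kd ≤ n := by
    rw [← hdimD]
    simpa [ZMod.card] using Submodule.finrank_le D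
  intro α α' hα₁ hα₂ hα'₁ hα'₂ h
  have hmem : shiftR (polyVec q : Vec n) (-α) - shiftR (polyVec q) (-α') ∈ C := by
    rw [← dualCode_dualCode C]
    intro c hc
    have hle : dualCode C ≤
        dualCode (F2 ∙ (shiftR (polyVec q : Vec n) (-α) - shiftR (polyVec q) (-α'))) := by
      refine hpR.le_of_shiftR_mem fun k hk w hw => ?_
      obtain ⟨a, rfl⟩ := Submodule.mem_span_singleton.1 hw
      have hk' := h (k + 1) (by omega) (by omega)
      rw [Nat.cast_succ, add_sub_cancel_right] at hk'
      rw [dot_comm]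
      refine (dotProduct_smul a _ _).trans ?_
      change a • dot _ _ = 0
      rw [dot_sub, hk', sub_self, smul_zero]
    rw [dot_comm]
    exact hle hc _ (Submodule.mem_span_singleton_self _)
  rcases lt_trichotomy α α' with hlt | heq | hgt
  · exact absurd hmem <| hp.shiftR_sub_shiftR_notMem hCcyc hq.monic.ne_zero
      (d := (α' - α).toNat) (by omega) (by omega) (by omega)
  · exact heq
  · rw [← Submodule.neg_mem_iff, neg_sub] at hmem
    exact absurd hmem <| hp.shiftR_sub_shiftR_notMem hCcyc hq.monic.ne_zero
      (d := (α - α').toNat) (by omega) (by omega) (by omega)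
end

section
/- Let W be a subspace of F₂ⁿ of dimension s such that no nonzero element of W is orthogonal to all of W (i.e., the standard dot product restricted to W is nondegenerate). Then there exists a basis (b₁,…,b_s) of W and a permutation σ of {1,…,s} with σ² = id such that for all l, l' ∈ {1,…,s}: b_l · b_{l'} = 1 if l' = σ(l), and b_l · b_{l'} = 0 otherwise. In particular, setting s^x_l = b_l and s^z_l = b_{σ(l)}, one obtains two bases of W (equal as sets) with s^x_l · s^z_l = 1 for all l and s^x_l · s^z_{l'} = 0 for l ≠ l'. -/
open Polynomial

open LinearMap (BilinForm)

/-- The family `b` is dual to its own reindexing by the involution `σ`, with respect to `B`. -/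
structure IsSelfDualFamily {K V ι : Type*} [Field K] [AddCommGroup V] [Module K V]
    [DecidableEq ι] (B : BilinForm K V) (b : ι → V) (σ : Equiv.Perm ι) : Prop where
  involutive : ∀ i, σ (σ i) = i
  apply_eq : ∀ i j, B (b i) (b j) = if j = σ i then 1 else 0

namespace IsSelfDualFamily

variable {K V ι κ : Type*} [Field K] [AddCommGroup V] [Module K V] [DecidableEq ι]
  [DecidableEq κ] {B : BilinForm K V} {b : ι → V} {σ : Equiv.Perm ι}

theorem apply_sum_smul [Fintype ι] (h : IsSelfDualFamily B b σ) (g : ι → K) (i : ι) :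
    B (b i) (∑ j, g j • b j) = g (σ i) := by
  simp [map_sum, h.apply_eq]

theorem linearIndependent [Fintype ι] (h : IsSelfDualFamily B b σ) :
    LinearIndependent K b := by
  refine Fintype.linearIndependent_iff.2 fun g hg i => ?_
  have := h.apply_sum_smul g (σ i)
  rwa [hg, map_zero, h.involutive, eq_comm] at this

theorem reindex (h : IsSelfDualFamily B b σ) (e : ι ≃ κ) :
    IsSelfDualFamily B (b ∘ e.symm) (e.permCongr σ) where
  involutive i := by simp [h.involutive]
  apply_eq i j := by
    rw [Function.comp_apply, Function.comp_apply, h.apply_eq]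
    exact if_congr (by simp [Equiv.symm_apply_eq]) rfl rfl

theorem sumElim {c : κ → V} {τ : Equiv.Perm κ} (hB : B.IsSymm) (h : IsSelfDualFamily B b σ)
    (h' : IsSelfDualFamily B c τ) (hbc : ∀ i k, B (b i) (c k) = 0) :
    IsSelfDualFamily B (Sum.elim b c) (Equiv.sumCongr σ τ) where
  involutive i := by cases i <;> simp [h.involutive, h'.involutive]
  apply_eq i j := by
    rcases i with i | i <;> rcases j with j | j
    · simp [h.apply_eq]
    · simp [hbc]
    · simpa using (hB.eq (b j) (c i)).symm.trans (hbc j i)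
    · simp [h'.apply_eq]

/-- A nonempty self-dual family in `W` splits off as an orthogonal summand of `W`. -/
theorem exists_orthogonal_complement [Fintype ι] [Nonempty ι] (hB : B.IsSymm)
    (h : IsSelfDualFamily B b σ) {W : Submodule K V} (hbW : ∀ i, b i ∈ W)
    (hW : ∀ w ∈ W, (∀ w' ∈ W, B w w' = 0) → w = 0) :
    ∃ U < W, (∀ i, ∀ u ∈ U, B (b i) u = 0) ∧ Submodule.span K (Set.range b) ⊔ U = W ∧
      ∀ u ∈ U, (∀ u' ∈ U, B u u' = 0) → u = 0 := by
  let U : Submodule K V := W ⊓ ⨅ i, LinearMap.ker (B (b i))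
  have mem_U {u : V} : u ∈ U ↔ u ∈ W ∧ ∀ i, B (b i) u = 0 := by simp [U]
  have exists_decomp : ∀ w ∈ W, ∃ g : ι → K, w - ∑ i, g i • b i ∈ U := fun w hw =>
    ⟨fun i => B (b (σ i)) w, mem_U.2
      ⟨W.sub_mem hw (W.sum_mem fun i _ => W.smul_mem _ (hbW i)), fun i => by
        rw [map_sub, h.apply_sum_smul, h.involutive, sub_self]⟩⟩
  refine ⟨U, lt_of_le_of_ne inf_le_left fun hUW => ?_, fun i u hu => (mem_U.1 hu).2 i, ?_, ?_⟩
  · obtain ⟨i⟩ := ‹Nonempty ι›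
    have h0 := (mem_U.1 (hUW ▸ hbW (σ i))).2 i
    simp [h.apply_eq] at h0
  · refine le_antisymm (sup_le (Submodule.span_le.2 (Set.range_subset_iff.2 hbW)) inf_le_left)
      fun w hw => ?_
    obtain ⟨g, hg⟩ := exists_decomp w hw
    exact Submodule.mem_sup.2 ⟨_, Submodule.sum_mem _ fun i _ => Submodule.smul_mem _ (g i)
      (Submodule.subset_span (Set.mem_range_self i)), _, hg, add_sub_cancel _ _⟩
  · intro u hu hu0
    refine hW u (mem_U.1 hu).1 fun w hw => ?_
    obtain ⟨g, hg⟩ := exists_decomp w hw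
    have hub : ∀ i, B u (b i) = 0 := fun i => by
      rw [← hB.eq]; simpa using (mem_U.1 hu).2 i
    simpa [map_sub, map_sum, hub] using hu0 _ hg

end IsSelfDualFamily

/-- A nonzero subspace on which `B` is nondegenerate contains a nonempty self-dual family: either a
single vector `v` with `B v v = 1`, or a hyperbolic pair. -/
theorem exists_isSelfDualFamily_of_ne_bot {V : Type*} [AddCommGroup V] [Module (ZMod 2) V]
    {B : BilinForm (ZMod 2) V} (hB : B.IsSymm) {W : Submodule (ZMod 2) V} (hbot : W ≠ ⊥)
    (hW : ∀ w ∈ W, (∀ w' ∈ W, B w w' = 0) → w = 0) :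
    ∃ (m : ℕ) (b : Fin (m + 1) → V) (σ : Equiv.Perm (Fin (m + 1))),
      IsSelfDualFamily B b σ ∧ ∀ i, b i ∈ W := by
  have eq_one : ∀ x : ZMod 2, x ≠ 0 → x = 1 := by decide
  by_cases hv : ∃ v ∈ W, B v v ≠ 0
  · obtain ⟨v, hvW, hv⟩ := hv
    refine ⟨0, fun _ => v, 1, ⟨fun _ => rfl, fun i j => ?_⟩, fun _ => hvW⟩
    simp [eq_one _ hv, Subsingleton.elim (α := Fin 1) j i]
  · push Not at hv
    obtain ⟨v, hvW, hv0⟩ := W.ne_bot_iff.1 hbot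
    obtain ⟨w, hwW, hvw⟩ : ∃ w ∈ W, B v w ≠ 0 := by
      by_contra! hcon
      exact hv0 (hW v hvW hcon)
    have hvw := eq_one _ hvw
    have hwv : B w v = 1 := by rw [← hB.eq]; simpa using hvw
    refine ⟨1, ![v, w], Equiv.swap 0 1, ⟨by decide, ?_⟩, by simp [Fin.forall_fin_two, hvW, hwW]⟩
    simp [Fin.forall_fin_two, hv v hvW, hv w hwW, hvw, hwv]

theorem exists_isSelfDualFamily_span_eq {V : Type*} [AddCommGroup V] [Module (ZMod 2) V]
    [FiniteDimensional (ZMod 2) V] {B : BilinForm (ZMod 2) V} (hB : B.IsSymm)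
    (W : Submodule (ZMod 2) V) (hW : ∀ w ∈ W, (∀ w' ∈ W, B w w' = 0) → w = 0) :
    ∃ (m : ℕ) (b : Fin m → V) (σ : Equiv.Perm (Fin m)),
      IsSelfDualFamily B b σ ∧ Submodule.span (ZMod 2) (Set.range b) = W := by
  induction W using WellFoundedLT.induction with
  | ind W ih =>
    rcases eq_or_ne W ⊥ with rfl | hbot
    · exact ⟨0, ![], 1, ⟨fun i => i.elim0, fun i => i.elim0⟩, by simp⟩
    obtain ⟨m, b, σ, hb, hbW⟩ := exists_isSelfDualFamily_of_ne_bot hB hbot hW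
    obtain ⟨U, hUW, hbU, hsup, hU⟩ := hb.exists_orthogonal_complement hB hbW hW
    obtain ⟨k, c, τ, hc, rfl⟩ := ih U hUW hU
    refine ⟨_, _, _, (hb.sumElim hB hc fun i j =>
      hbU i _ (Submodule.subset_span (Set.mem_range_self j))).reindex finSumFinEquiv, ?_⟩
    rw [Equiv.surjective _ |>.range_comp, Set.Sum.elim_range, Submodule.span_union, hsup]

/-- (Correctness of Algorithm 1.) If the dot product is nondegenerate
on an `s`-dimensional subspace `W ⊆ F₂ⁿ`, then `W` has a basis `b₁,…,b_s` and an
involutive permutation `σ` with `b_l · b_{l'} = 1` iff `l' = σ(l)`. -/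
theorem stmt13 (n s : ℕ) (W : Submodule F2 (Fin n → F2))
    (hdim : Module.finrank F2 W = s)
    (hnondeg : ∀ w ∈ W, (∀ w' ∈ W, dot w w' = 0) → w = 0) :
    ∃ (b : Fin s → (Fin n → F2)) (σ : Equiv.Perm (Fin s)),
      (∀ l, σ (σ l) = l) ∧
      LinearIndependent F2 b ∧
      Submodule.span F2 (Set.range b) = W ∧
      (∀ l l', dot (b l) (b l') = if l' = σ l then 1 else 0) := by
  have hB : BilinForm.IsSymm (dotProductBilin F2 F2 : BilinForm F2 (Fin n → F2)) :=
    ⟨fun u v => dotProduct_comm u v⟩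
  obtain ⟨m, b, σ, hb, hspan⟩ := exists_isSelfDualFamily_span_eq hB W hnondeg
  obtain rfl : m = s := by
    rw [← hdim, ← hspan, finrank_span_eq_card hb.linearIndependent, Fintype.card_fin]
  exact ⟨b, σ, hb.involutive, hb.linearIndependent, hspan, hb.apply_eq⟩
end

section
/- Let V be an r-dimensional subspace of F₂^{2n}. Then there exist nonnegative integers p, q with 2p + q = r and a symplectic basis of F₂^{2n}, consisting of vectors u₁,…,u_n, v₁,…,v_n with u_i ⊙ u_j = 0 and v_i ⊙ v_j = 0 for all i, j, u_i ⊙ v_i = 1 for all i, and u_i ⊙ v_j = 0 for i ≠ j, such that {u₁,…,u_{p+q}, v₁,…,v_p} is a basis of V. Equivalently, V = symp(V) ⊕ iso(V), where symp(V) = span{u₁,…,u_p, v₁,…,v_p} is a symplectic subspace and iso(V) = span{u_{p+1},…,u_{p+q}} is an isotropic subspace. -/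
open Polynomial

/-- The symplectic product on `F₂^{2n}`, written as pairs `(x|z)`. -/
def symp {n : ℕ} (u v : (Fin n → F2) × (Fin n → F2)) : F2 :=
  dot u.1 v.2 + dot u.2 v.1

section SymplecticGramSchmidt

variable {K E : Type*} [Field K] [AddCommGroup E] [Module K E]

/-- The families `u`, `v` satisfy the relations of a symplectic basis for the form `B`. -/
structure IsSymplecticFamily (B : E →ₗ[K] E →ₗ[K] K) {ι : Type*} (u v : ι → E) : Prop where
  left_left : ∀ i j, B (u i) (u j) = 0
  right_right : ∀ i j, B (v i) (v j) = 0
  left_right_self : ∀ i, B (u i) (v i) = 1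
  left_right_of_ne : ∀ i j, i ≠ j → B (u i) (v j) = 0

/-- The restriction of the form `B` to the subspace `W` is nondegenerate. -/
def NondegenerateOn (B : E →ₗ[K] E →ₗ[K] K) (W : Submodule K E) : Prop :=
  ∀ x ∈ W, (∀ y ∈ W, B x y = 0) → x = 0

theorem IsSymplecticFamily.linearIndependent {B : E →ₗ[K] E →ₗ[K] K} (hB : B.IsAlt)
    {ι : Type*} [Fintype ι] {u v : ι → E} (h : IsSymplecticFamily B u v) :
    LinearIndependent K (Sum.elim u v) := by
  classical
  have hvu : ∀ i j, B (v i) (u j) = if i = j then -1 else 0 := by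
    intro i j
    rw [← hB.neg (u j) (v i)]
    split_ifs with hij
    · rw [hij, h.left_right_self]
    · rw [h.left_right_of_ne j i (Ne.symm hij), neg_zero]
  have huv : ∀ i j, B (u i) (v j) = if i = j then 1 else 0 := by
    intro i j
    split_ifs with hij
    · rw [hij, h.left_right_self]
    · exact h.left_right_of_ne i j hij
  rw [Fintype.linearIndependent_iff]
  intro g hg
  rw [Fintype.sum_sum_type] at hg
  simp only [Sum.elim_inl, Sum.elim_inr] at hg
  rintro (i | i)
  · simpa [huv, h.right_right] using congrArg (fun x => B x (v i)) hg
  · simpa [hvu, h.left_left] using congrArg (fun x => B x (u i)) hg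

theorem IsSymplecticFamily.cons {B : E →ₗ[K] E →ₗ[K] K} (hB : B.IsAlt) {n : ℕ}
    {u v : Fin n → E} (h : IsSymplecticFamily B u v) {a b : E} (hab : B a b = 1)
    (hu : ∀ i, B a (u i) = 0 ∧ B b (u i) = 0) (hv : ∀ i, B a (v i) = 0 ∧ B b (v i) = 0) :
    IsSymplecticFamily B (Fin.cons a u : Fin (n + 1) → E) (Fin.cons b v) := by
  have hua : ∀ i, B (u i) a = 0 := fun i => by rw [← hB.neg, (hu i).1, neg_zero]
  have hub : ∀ i, B (u i) b = 0 := fun i => by rw [← hB.neg, (hu i).2, neg_zero]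
  have hvb : ∀ i, B (v i) b = 0 := fun i => by rw [← hB.neg, (hv i).2, neg_zero]
  refine ⟨fun i j => ?_, fun i j => ?_, fun i => ?_, fun i j hij => ?_⟩
  · refine Fin.cases ?_ (fun i => ?_) i <;> refine Fin.cases ?_ (fun j => ?_) j <;>
      simp [hB a, hu, hua, h.left_left]
  · refine Fin.cases ?_ (fun i => ?_) i <;> refine Fin.cases ?_ (fun j => ?_) j <;>
      simp [hB b, hv, hvb, h.right_right]
  · refine Fin.cases ?_ (fun i => ?_) i <;> simp [hab, h.left_right_self]
  · revert hij
    refine Fin.cases ?_ (fun i => ?_) i <;> refine Fin.cases ?_ (fun j => ?_) j <;>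
      simp +contextual [hv, hub, h.left_right_of_ne]

/-- Splitting a hyperbolic pair off a nondegenerate subspace. -/
theorem NondegenerateOn.exists_hyperbolic_complement [FiniteDimensional K E]
    {B : E →ₗ[K] E →ₗ[K] K} (hB : B.IsAlt) {W : Submodule K E} (hW : NondegenerateOn B W)
    {n : ℕ} (hn : Module.finrank K W = 2 * (n + 1)) {a b : E} (ha : a ∈ W) (hb : b ∈ W)
    (hab : B a b = 1) :
    ∃ W' ≤ W, Module.finrank K W' = 2 * n ∧ NondegenerateOn B W' ∧
      (∀ x ∈ W', B a x = 0 ∧ B b x = 0) ∧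
      ∀ x ∈ W, x - B x b • a + B x a • b ∈ W' := by
  have hba : B b a = -1 := by rw [← hB.neg, hab]
  let f : W →ₗ[K] K × K := ((B a).prod (B b)).comp W.subtype
  have hf : LinearMap.range f = ⊤ := by
    rw [LinearMap.range_eq_top]
    rintro ⟨s, t⟩
    refine ⟨s • ⟨b, hb⟩ - t • ⟨a, ha⟩, ?_⟩
    simp [f, hab, hba, hB a, hB b]
  have hmem : ∀ x, x ∈ (LinearMap.ker f).map W.subtype ↔ x ∈ W ∧ B a x = 0 ∧ B b x = 0 := by
    intro x
    simp [f, Submodule.mem_map, and_comm, and_left_comm]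
  have hsplit : ∀ x ∈ W, x - B x b • a + B x a • b ∈ (LinearMap.ker f).map W.subtype := by
    intro x hx
    rw [hmem]
    refine ⟨W.add_mem (W.sub_mem hx (W.smul_mem _ ha)) (W.smul_mem _ hb), ?_, ?_⟩
    · simp [hB a, hab, ← hB.neg a x]
    · simp [hB b, hba, ← hB.neg b x]
  refine ⟨(LinearMap.ker f).map W.subtype, Submodule.map_subtype_le _ _, ?_, ?_,
    fun x hx => ((hmem x).1 hx).2, hsplit⟩
  · have h := f.finrank_range_add_finrank_ker
    rw [hf, finrank_top, Module.finrank_prod, Module.finrank_self, hn] at h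
    rw [Submodule.finrank_map_subtype_eq]
    omega
  · intro x hx hx'
    obtain ⟨hxW, hax, hbx⟩ := (hmem x).1 hx
    refine hW x hxW fun y hy => ?_
    have h := hx' _ (hsplit y hy)
    have hxa : B x a = 0 := by rw [← hB.neg, hax, neg_zero]
    have hxb : B x b = 0 := by rw [← hB.neg, hbx, neg_zero]
    simpa [hxa, hxb] using h

theorem NondegenerateOn.exists_eq_one {B : E →ₗ[K] E →ₗ[K] K} {W : Submodule K E}
    (hW : NondegenerateOn B W) {a : E} (ha : a ∈ W) (ha0 : a ≠ 0) : ∃ b ∈ W, B a b = 1 := by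
  by_contra! h
  refine ha0 (hW a ha fun y hy => ?_)
  by_contra hy0
  exact h ((B a y)⁻¹ • y) (W.smul_mem _ hy) (by simp [hy0])

/-- A symplectic family of the nondegenerate subspace `W` adapted to the subspace `V`. -/
theorem NondegenerateOn.exists_adapted_family [FiniteDimensional K E]
    {B : E →ₗ[K] E →ₗ[K] K} (hB : B.IsAlt) (n : ℕ) :
    ∀ {W V : Submodule K E}, NondegenerateOn B W → Module.finrank K W = 2 * n → V ≤ W →
    ∃ (p q : ℕ) (u v : Fin n → E), p + q ≤ n ∧ (∀ i, u i ∈ W) ∧ (∀ i, v i ∈ W) ∧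
      IsSymplecticFamily B u v ∧
      Submodule.span K (u '' {i | (i : ℕ) < p + q} ∪ v '' {i | (i : ℕ) < p}) = V := by
  induction n with
  | zero =>
    intro W V _ hn hVW
    have hV : V = ⊥ := by
      have hW : W = ⊥ := by simpa using hn
      exact le_bot_iff.1 (hVW.trans hW.le)
    refine ⟨0, 0, Fin.elim0, Fin.elim0, le_rfl, fun i => i.elim0, fun i => i.elim0,
      ⟨fun i => i.elim0, fun i => i.elim0, fun i => i.elim0, fun i => i.elim0⟩, by simp [hV]⟩
  | succ n ih =>
    intro W V hW hn hVW
    by_cases hV : ∃ a ∈ V, ∃ c ∈ V, B a c ≠ 0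
    · obtain ⟨a, ha, c, hc, hac⟩ := hV
      obtain ⟨b, hb, hab⟩ : ∃ b ∈ V, B a b = 1 :=
        ⟨(B a c)⁻¹ • c, V.smul_mem _ hc, by simp [hac]⟩
      obtain ⟨W', hW'W, hn', hW', horth, hsplit⟩ :=
        hW.exists_hyperbolic_complement hB hn (hVW ha) (hVW hb) hab
      obtain ⟨p, q, u, v, hpq, hu, hv, huv, hspan⟩ :=
        ih hW' hn' (inf_le_right : V ⊓ W' ≤ W')
      refine ⟨p + 1, q, Fin.cons a u, Fin.cons b v, by omega,
        Fin.cases (hVW ha) fun i => hW'W (hu i), Fin.cases (hVW hb) fun i => hW'W (hv i),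
        huv.cons hB hab (fun i => horth _ (hu i)) (fun i => horth _ (hv i)), ?_⟩
      have hold : ∀ x ∈ u '' {i | (i : ℕ) < p + q} ∪ v '' {i | (i : ℕ) < p}, x ∈ V :=
        fun x hx => (hspan.le (Submodule.subset_span hx)).1
      apply le_antisymm
      · rw [Submodule.span_le]
        rintro _ (⟨i, hi, rfl⟩ | ⟨i, hi, rfl⟩) <;> revert hi <;>
          refine Fin.cases (fun _ => ?_) (fun i hi => ?_) i
        · exact ha
        · exact hold _ (Or.inl ⟨i, by simp at hi ⊢; omega, rfl⟩)
        · exact hb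
        · exact hold _ (Or.inr ⟨i, by simp at hi ⊢; omega, rfl⟩)
      · intro x hx
        have hx' : x - B x b • a + B x a • b ∈ V ⊓ W' :=
          ⟨V.add_mem (V.sub_mem hx (V.smul_mem _ ha)) (V.smul_mem _ hb), hsplit x (hVW hx)⟩
        rw [← hspan] at hx'
        have hxe : x = (x - B x b • a + B x a • b) + B x b • a - B x a • b := by abel
        rw [hxe]
        refine Submodule.sub_mem _ (Submodule.add_mem _ (Submodule.span_mono ?_ hx')
          (Submodule.smul_mem _ _ (Submodule.subset_span (Or.inl ⟨0, by simp, rfl⟩))))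
          (Submodule.smul_mem _ _ (Submodule.subset_span (Or.inr ⟨0, by simp, rfl⟩)))
        rintro _ (⟨i, hi, rfl⟩ | ⟨i, hi, rfl⟩)
        · exact Or.inl ⟨i.succ, by simp at hi ⊢; omega, rfl⟩
        · exact Or.inr ⟨i.succ, by simp at hi ⊢; omega, rfl⟩
    · push Not at hV
      by_cases hV0 : V = ⊥
      · obtain ⟨a, ha, ha0⟩ : ∃ a ∈ W, a ≠ 0 := by
          apply W.exists_mem_ne_zero_of_ne_bot
          rintro rfl
          simp at hn
        obtain ⟨b, hb, hab⟩ := hW.exists_eq_one ha ha0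
        obtain ⟨W', hW'W, hn', hW', horth, -⟩ :=
          hW.exists_hyperbolic_complement hB hn ha hb hab
        obtain ⟨-, -, u, v, -, hu, hv, huv, -⟩ := ih hW' hn' (bot_le : ⊥ ≤ W')
        exact ⟨0, 0, Fin.cons a u, Fin.cons b v, by omega,
          Fin.cases ha fun i => hW'W (hu i), Fin.cases hb fun i => hW'W (hv i),
          huv.cons hB hab (fun i => horth _ (hu i)) (fun i => horth _ (hv i)), by simp [hV0]⟩
      · obtain ⟨a, ha, ha0⟩ := V.exists_mem_ne_zero_of_ne_bot hV0
        obtain ⟨b, hb, hab⟩ := hW.exists_eq_one (hVW ha) ha0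
        obtain ⟨W', hW'W, hn', hW', horth, hsplit⟩ :=
          hW.exists_hyperbolic_complement hB hn (hVW ha) hb hab
        obtain ⟨p, q, u, v, hpq, hu, hv, huv, hspan⟩ :=
          ih hW' hn' (inf_le_right : V ⊓ W' ≤ W')
        have hold : ∀ x ∈ u '' {i | (i : ℕ) < p + q} ∪ v '' {i | (i : ℕ) < p}, x ∈ V :=
          fun x hx => (hspan.le (Submodule.subset_span hx)).1
        obtain rfl : p = 0 := by
          by_contra hp
          let i : Fin n := ⟨0, by omega⟩
          have h := hV (u i) (hold _ (Or.inl ⟨i, by simp [i]; omega, rfl⟩))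
            (v i) (hold _ (Or.inr ⟨i, by simp [i]; omega, rfl⟩))
          rw [huv.left_right_self] at h
          exact one_ne_zero h
        refine ⟨0, q + 1, Fin.cons a u, Fin.cons b v, by omega,
          Fin.cases (hVW ha) fun i => hW'W (hu i), Fin.cases hb fun i => hW'W (hv i),
          huv.cons hB hab (fun i => horth _ (hu i)) (fun i => horth _ (hv i)), ?_⟩
        apply le_antisymm
        · rw [Submodule.span_le]
          rintro _ (⟨i, hi, rfl⟩ | ⟨i, hi, rfl⟩)
          · revert hi
            refine Fin.cases (fun _ => ha) (fun i hi => ?_) i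
            exact hold _ (Or.inl ⟨i, by simp at hi ⊢; omega, rfl⟩)
          · simp at hi
        · intro x hx
          have hx' : x - B x b • a ∈ V ⊓ W' := by
            refine ⟨V.sub_mem hx (V.smul_mem _ ha), ?_⟩
            simpa [hV x hx a ha] using hsplit x (hVW hx)
          rw [← hspan] at hx'
          rw [← sub_add_cancel x (B x b • a)]
          refine Submodule.add_mem _ (Submodule.span_mono ?_ hx')
            (Submodule.smul_mem _ _ (Submodule.subset_span (Or.inl ⟨0, by simp, rfl⟩)))
          rintro _ (⟨i, hi, rfl⟩ | ⟨i, hi, rfl⟩)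
          · exact Or.inl ⟨i.succ, by simp at hi ⊢; omega, rfl⟩
          · simp at hi

end SymplecticGramSchmidt

/-- The symplectic product as a bilinear map. -/
def sympForm (n : ℕ) : ((Fin n → F2) × (Fin n → F2)) →ₗ[F2]
    ((Fin n → F2) × (Fin n → F2)) →ₗ[F2] F2 :=
  LinearMap.mk₂ F2 symp
    (fun x y z => by simp [symp, dot, add_mul, Finset.sum_add_distrib]; abel)
    (fun c x y => by simp [symp, dot, Finset.mul_sum, mul_add, mul_assoc])
    (fun x y z => by simp [symp, dot, mul_add, Finset.sum_add_distrib]; abel)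
    (fun c x y => by simp [symp, dot, Finset.mul_sum, mul_add, mul_left_comm])

theorem sympForm_isAlt (n : ℕ) : (sympForm n).IsAlt := by
  intro x
  change dot x.1 x.2 + dot x.2 x.1 = 0
  have h : dot x.2 x.1 = dot x.1 x.2 := Finset.sum_congr rfl fun i _ => mul_comm _ _
  rw [h, CharTwo.add_self_eq_zero]

theorem sympForm_nondegenerateOn_top (n : ℕ) : NondegenerateOn (sympForm n) ⊤ := by
  intro x _ hx
  ext i
  · simpa [sympForm, symp, dot, Pi.single_apply] using hx (0, Pi.single i 1) trivial
  · simpa [sympForm, symp, dot, Pi.single_apply] using hx (Pi.single i 1, 0) trivial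

/-- (Symplectic Gram–Schmidt decomposition.) Every `r`-dimensional
subspace `V ⊆ F₂^{2n}` admits a symplectic basis `u₁,…,u_n, v₁,…,v_n` of `F₂^{2n}` and
`p, q` with `2p + q = r` such that `{u₁,…,u_{p+q}, v₁,…,v_p}` is a basis of `V`. -/
theorem stmt15 (n r : ℕ) (V : Submodule F2 ((Fin n → F2) × (Fin n → F2)))
    (hr : Module.finrank F2 V = r) :
    ∃ (p q : ℕ) (u v : Fin n → (Fin n → F2) × (Fin n → F2)),
      2 * p + q = r ∧ p + q ≤ n ∧
      LinearIndependent F2 (Sum.elim u v) ∧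
      Submodule.span F2 (Set.range u ∪ Set.range v) = ⊤ ∧
      (∀ i j, symp (u i) (u j) = 0) ∧
      (∀ i j, symp (v i) (v j) = 0) ∧
      (∀ i, symp (u i) (v i) = 1) ∧
      (∀ i j, i ≠ j → symp (u i) (v j) = 0) ∧
      Submodule.span F2 (u '' {i | (i : ℕ) < p + q} ∪ v '' {i | (i : ℕ) < p}) = V := by
  have hdim : Module.finrank F2 ((Fin n → F2) × (Fin n → F2)) = 2 * n := by
    simp [two_mul]
  obtain ⟨p, q, u, v, hpq, -, -, huv, hspan⟩ :=
    (sympForm_nondegenerateOn_top n).exists_adapted_family (sympForm_isAlt n) n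
      (by rw [finrank_top, hdim]) (le_top : V ≤ ⊤)
  have hli := huv.linearIndependent (sympForm_isAlt n)
  refine ⟨p, q, u, v, ?_, hpq, hli, ?_, huv.left_left, huv.right_right, huv.left_right_self,
    huv.left_right_of_ne, hspan⟩
  · let w : Fin (p + q) ⊕ Fin p → Fin n ⊕ Fin n :=
      Sum.map (Fin.castLE hpq) (Fin.castLE (by omega))
    have hw : Function.Injective w :=
      Sum.map_injective.2 ⟨Fin.castLE_injective _, Fin.castLE_injective _⟩
    have hrange : Set.range (Sum.elim u v ∘ w) =
        u '' {i | (i : ℕ) < p + q} ∪ v '' {i | (i : ℕ) < p} := by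
      rw [Sum.elim_comp_map, Set.Sum.elim_range, Set.range_comp, Set.range_comp,
        Fin.range_castLE, Fin.range_castLE]
    have hcard := finrank_span_eq_card (hli.comp w hw)
    rw [hrange, hspan, hr] at hcard
    simp at hcard
    omega
  · rw [← Set.Sum.elim_range]
    exact hli.span_eq_top_of_card_eq_finrank' (by rw [hdim]; simp [two_mul])
end
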